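/- There exist universal constants C, c > 0 such that the following holds. Let μ be either the Gaussian measure N(0, I_d/d) on ℝ^d or the uniform measure on the unit ball B_d, let U ⊆ ℝ^d be a measurable set with μ(U) > 0, and let A_1, A_2 ∈ ℝ^{d×d}. Define f_1(x) = A_1 x and f_2(x) = A_2 x. Then for any κ ≥ C·(1 + log(1/μ(U))): E_{x∼μ|_U} ‖f_1(x) − f_2(x)‖² ≥ (c/d) · min over matrices M with rank(M) ≤ κ of ‖A_1 − A_2 − M‖_F². -/

import Mathlib

open MeasureTheory ProbabilityTheory Matrix
open scoped ENNReal NNReal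

noncomputable section

/-- Squared Euclidean norm on `ℝ^d`. -/
def sqNorm {d : ℕ} (v : Fin d → ℝ) : ℝ := ∑ i, (v i) ^ 2

/-- Squared Frobenius norm of a matrix. -/
def frobSq {a b : ℕ} (M : Matrix (Fin a) (Fin b) ℝ) : ℝ := ∑ i, ∑ j, (M i j) ^ 2

/-- The Gaussian measure `N(0, I_d/d)` on `ℝ^d`: product of `d` i.i.d. centered Gaussians of
variance `1/d`. -/
def stdGaussianScaled (d : ℕ) : Measure (Fin d → ℝ) :=
  Measure.pi fun _ => gaussianReal 0 ((d : ℝ≥0))⁻¹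

/-- The Euclidean unit ball in `ℝ^d`. -/
def unitBall (d : ℕ) : Set (Fin d → ℝ) := {x | ∑ i, (x i) ^ 2 ≤ 1}

/-- The uniform probability measure on the Euclidean unit ball of `ℝ^d`. -/
def uniformBall (d : ℕ) : Measure (Fin d → ℝ) :=
  (volume (unitBall d))⁻¹ • volume.restrict (unitBall d)

lemma orth_change {d : ℕ} (V : Matrix (Fin d) (Fin d) ℝ) (hV : Vᵀ * V = 1)
    (f : (Fin d → ℝ) → ℝ≥0∞) (hf : Measurable f) :
    ∫⁻ z, f (V.mulVec z) = ∫⁻ z, f z := by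
  have hdet : V.det * V.det = 1 := by
    have := congrArg Matrix.det hV
    simpa using this
  have h0 : V.det ≠ 0 := by
    intro h; rw [h] at hdet; simp at hdet
  have habs : |V.det| = 1 := by
    rcases mul_self_eq_one_iff.mp hdet with h | h <;> simp [h]
  have hm := Real.map_matrix_volume_pi_eq_smul_volume_pi h0
  rw [abs_inv, habs] at hm
  simp only [inv_one, ENNReal.ofReal_one, one_smul] at hm
  have hmeas : Measurable (Matrix.toLin' V : (Fin d → ℝ) → (Fin d → ℝ)) := 
    (LinearMap.continuous_of_finiteDimensional _).measurable
  conv_rhs => rw [← hm, lintegral_map hf hmeas]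
  simp [Matrix.toLin'_apply]

lemma gauss_int {d : ℕ} (b : Fin d → ℝ) (hb : ∀ i, 0 < b i) :
    ∫⁻ x : Fin d → ℝ, ENNReal.ofReal (Real.exp (-∑ i, b i * (x i) ^ 2)) =
      ENNReal.ofReal (∏ i, √(Real.pi / b i)) := by
  have key : ∀ x : Fin d → ℝ, Real.exp (-∑ i, b i * (x i) ^ 2)
      = ∏ i, Real.exp (- b i * (x i) ^ 2) := by
    intro x
    rw [← Real.exp_sum, ← Finset.sum_neg_distrib]
    simp
  simp_rw [key]
  rw [← ofReal_integral_eq_lintegral_ofReal]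
  · rw [integral_fintype_prod_volume_eq_prod (f := fun i (x : ℝ) => Real.exp (- b i * x ^ 2))]
    simp_rw [integral_gaussian]
  · exact Integrable.fintype_prod (f := fun i (x : ℝ) => Real.exp (- b i * x ^ 2))
      (fun i => integrable_exp_neg_mul_sq (hb i))
  · exact Filter.Eventually.of_forall fun x => by positivity

lemma decomp {d : ℕ} (A : Matrix (Fin d) (Fin d) ℝ) :
    ∃ (V : Matrix (Fin d) (Fin d) ℝ) (l : Fin d → ℝ), Vᵀ * V = 1 ∧ (∀ i, 0 ≤ l i) ∧
      Vᵀ * (Aᵀ * A) * V = Matrix.diagonal l := by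
  have hP : (Aᵀ * A).PosSemidef := by
    have := Matrix.posSemidef_conjTranspose_mul_self A
    simpa using this
  have hH := hP.isHermitian
  refine ⟨(hH.eigenvectorUnitary : Matrix (Fin d) (Fin d) ℝ), hH.eigenvalues, ?_,
    hP.eigenvalues_nonneg, ?_⟩
  · have := (Matrix.mem_unitaryGroup_iff' (A := (hH.eigenvectorUnitary : Matrix (Fin d) (Fin d) ℝ))).1
      hH.eigenvectorUnitary.2
    simpa [Matrix.star_eq_conjTranspose] using this
  · have := hH.conjStarAlgAut_star_eigenvectorUnitary
    rw [Unitary.conjStarAlgAut_apply] at this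
    simpa [Matrix.star_eq_conjTranspose] using this

lemma sqNorm_eq {d : ℕ} (v : Fin d → ℝ) : sqNorm v = v ⬝ᵥ v := by
  simp [sqNorm, dotProduct, sq]

lemma sqNorm_nonneg {d : ℕ} (v : Fin d → ℝ) : 0 ≤ sqNorm v :=
  Finset.sum_nonneg fun _ _ => sq_nonneg _

lemma sqNorm_diag {d : ℕ} (A V : Matrix (Fin d) (Fin d) ℝ) (l : Fin d → ℝ)
    (h : Vᵀ * (Aᵀ * A) * V = Matrix.diagonal l) (z : Fin d → ℝ) :
    sqNorm (A.mulVec (V.mulVec z)) = ∑ i, l i * (z i) ^ 2 := by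
  have : sqNorm (A.mulVec (V.mulVec z)) = z ⬝ᵥ ((Vᵀ * (Aᵀ * A) * V).mulVec z) := by
    rw [sqNorm_eq]
    simp only [← Matrix.mulVec_mulVec, Matrix.dotProduct_mulVec, Matrix.vecMul_transpose]
  rw [this, h]
  simp only [dotProduct, Matrix.mulVec_diagonal]
  exact Finset.sum_congr rfl fun i _ => by ring

@[fun_prop]
lemma sqNorm_meas {d : ℕ} : Measurable (sqNorm : (Fin d → ℝ) → ℝ) := by
  unfold sqNorm; fun_prop

@[fun_prop]
lemma mulVec_meas {d : ℕ} (A : Matrix (Fin d) (Fin d) ℝ) :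
    Measurable (fun x : Fin d → ℝ => A.mulVec x) := by
  exact (LinearMap.continuous_of_finiteDimensional (Matrix.toLin' A)).measurable

/-- weighted Gaussian integral -/
def GG {d : ℕ} (A : Matrix (Fin d) (Fin d) ℝ) (s : ℝ) : ℝ≥0∞ :=
  ∫⁻ x : Fin d → ℝ, ENNReal.ofReal (Real.exp (-s * sqNorm (A.mulVec x))) *
    ENNReal.ofReal (Real.exp (-(d / 2 : ℝ) * sqNorm x))

lemma GG_eq {d : ℕ} (hd : 0 < d) (A V : Matrix (Fin d) (Fin d) ℝ) (l : Fin d → ℝ)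
    (hV : Vᵀ * V = 1) (hl : ∀ i, 0 ≤ l i)
    (h : Vᵀ * (Aᵀ * A) * V = Matrix.diagonal l) (s : ℝ) (hs : 0 ≤ s) :
    GG A s = ENNReal.ofReal (∏ i, √(Real.pi / (s * l i + d / 2))) := by
  unfold GG
  rw [← orth_change V hV _ (by fun_prop), ← gauss_int]
  · refine lintegral_congr fun z => ?_
    rw [sqNorm_diag A V l h]
    have : sqNorm (V.mulVec z) = ∑ i, z i ^ 2 := by
      have := sqNorm_diag 1 V (fun _ => 1) (by simpa using hV) z
      simpa using this
    rw [this, ← ENNReal.ofReal_mul (by positivity), ← Real.exp_add]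
    congr 2
    rw [Finset.mul_sum, Finset.mul_sum, ← Finset.sum_add_distrib, ← Finset.sum_neg_distrib]
    exact Finset.sum_congr rfl fun i _ => by ring
  · intro i
    have := hl i
    positivity

lemma GG_ratio {d : ℕ} (hd : 0 < d) (A V : Matrix (Fin d) (Fin d) ℝ) (l : Fin d → ℝ)
    (hV : Vᵀ * V = 1) (hl : ∀ i, 0 ≤ l i)
    (h : Vᵀ * (Aᵀ * A) * V = Matrix.diagonal l) (s : ℝ) (hs : 0 ≤ s) :
    GG A s = ENNReal.ofReal (Real.exp (- (1/2) * ∑ i, Real.log (1 + 2 * s * l i / d))) * GG A 0 := by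
  rw [GG_eq hd A V l hV hl h s hs, GG_eq hd A V l hV hl h 0 le_rfl, 
    ← ENNReal.ofReal_mul (by positivity)]
  congr 1
  rw [Finset.mul_sum, Real.exp_sum, ← Finset.prod_mul_distrib]
  refine Finset.prod_congr rfl fun i _ => ?_
  have hd' : (0:ℝ) < d := by exact_mod_cast hd
  have h1 : 0 < 1 + 2 * s * l i / d := by
    have := hl i
    positivity
  have : Real.pi / (s * l i + d / 2) = (1 + 2 * s * l i / d)⁻¹ * (Real.pi / (0 * l i + d/2)) := by
    have := hl i
    have : 0 < s * l i + d / 2 := by positivity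
    field_simp
    ring
  rw [this, Real.sqrt_mul (by positivity)]
  congr 1
  rw [Real.sqrt_eq_rpow, Real.rpow_def_of_pos (by positivity), Real.log_inv]
  congr 1; ring

lemma GG_zero {d : ℕ} (hd : 0 < d) (A : Matrix (Fin d) (Fin d) ℝ) : GG A 0 ≠ 0 ∧ GG A 0 ≠ ∞ := by
  obtain ⟨V, l, hV, hl, h⟩ := decomp A
  rw [GG_eq hd A V l hV hl h 0 le_rfl]
  refine ⟨?_, ENNReal.ofReal_ne_top⟩
  rw [← pos_iff_ne_zero, ENNReal.ofReal_pos]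
  refine Finset.prod_pos fun i _ => ?_
  have hd' : (0:ℝ) < d := by exact_mod_cast hd
  have := Real.pi_pos
  apply Real.sqrt_pos.2
  simp; positivity

lemma gauss_meas {d : ℕ} (hd : 0 < d) : ∃ K : ℝ≥0∞, stdGaussianScaled d =
    (volume : Measure (Fin d → ℝ)).withDensity 
      (fun x => K * ENNReal.ofReal (Real.exp (-(d / 2 : ℝ) * sqNorm x))) := by
  have hd' : (0:ℝ) < d := by exact_mod_cast hd
  have hv : ((d : ℝ≥0))⁻¹ ≠ 0 := by
    simp; omega
  set v : ℝ≥0 := (d : ℝ≥0)⁻¹ with hvdef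
  refine ⟨ENNReal.ofReal ((√(2 * Real.pi * v))⁻¹ ^ d), ?_⟩
  have hdens : (fun x : Fin d → ℝ => ENNReal.ofReal ((√(2 * Real.pi * v))⁻¹ ^ d) * 
      ENNReal.ofReal (Real.exp (-(d / 2 : ℝ) * sqNorm x))) = 
      fun x => ENNReal.ofReal (∏ i, gaussianPDFReal 0 v (x i)) := by
    funext x
    rw [← ENNReal.ofReal_mul (by positivity)]
    congr 1
    simp only [gaussianPDFReal]
    rw [Finset.prod_mul_distrib, ← Real.exp_sum]
    simp only [Finset.prod_const, Finset.card_univ, Fintype.card_fin]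
    congr 2
    rw [sqNorm, Finset.mul_sum]
    refine Finset.sum_congr rfl fun i _ => ?_
    simp only [hvdef]
    push_cast
    field_simp
    ring
  rw [hdens]
  unfold stdGaussianScaled
  refine Measure.pi_eq fun s hs => ?_
  rw [withDensity_apply _ (MeasurableSet.univ_pi hs)]
  rw [volume_pi, Measure.restrict_pi_pi, ← ofReal_integral_eq_lintegral_ofReal]
  · rw [integral_fintype_prod_eq_prod (f := fun (i : Fin d) (x : ℝ) => gaussianPDFReal 0 v x)]
    rw [ENNReal.ofReal_prod_of_nonneg]
    · refine Finset.prod_congr rfl fun i _ => ?_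
      rw [gaussianReal_apply_eq_integral _ hv]
    · intro i _
      exact integral_nonneg fun x => gaussianPDFReal_nonneg _ _ _
  · exact Integrable.fintype_prod (f := fun (i : Fin d) (x : ℝ) => gaussianPDFReal 0 v x)
      (fun i => (integrable_gaussianPDFReal 0 v).restrict)
  · exact Filter.Eventually.of_forall fun x => 
      Finset.prod_nonneg fun i _ => gaussianPDFReal_nonneg _ _ _

instance gauss_prob (d : ℕ) : IsProbabilityMeasure (stdGaussianScaled d) := by
  unfold stdGaussianScaled; infer_instance

lemma gauss_laplace {d : ℕ} (hd : 0 < d) (A : Matrix (Fin d) (Fin d) ℝ) (s : ℝ) :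
    (∫⁻ x, ENNReal.ofReal (Real.exp (-s * sqNorm (A.mulVec x))) ∂(stdGaussianScaled d)) * GG A 0
      = GG A s := by
  obtain ⟨K, hK⟩ := gauss_meas hd
  have key : ∀ s, ∫⁻ x, ENNReal.ofReal (Real.exp (-s * sqNorm (A.mulVec x))) ∂(stdGaussianScaled d) 
      = K * GG A s := by
    intro s
    rw [hK, lintegral_withDensity_eq_lintegral_mul _ (by fun_prop) (by fun_prop), GG,
      ← lintegral_const_mul _ (by fun_prop)]
    refine lintegral_congr fun x => ?_
    simp only [Pi.mul_apply]
    ring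
  have h0 := key 0
  simp only [neg_zero, zero_mul, Real.exp_zero, ENNReal.ofReal_one, lintegral_one, measure_univ] at h0
  rw [key s, mul_right_comm, ← h0, one_mul]

lemma gauss_memLp (d : ℕ) (j : Fin d) : MemLp (fun x : Fin d → ℝ => x j) 2 (stdGaussianScaled d) := by
  have h := memLp_id_gaussianReal' (μ := 0) (v := (d : ℝ≥0)⁻¹) 2 (by simp)
  have mp := measurePreserving_eval (fun _ : Fin d => gaussianReal 0 ((d : ℝ≥0))⁻¹) j
  exact h.comp_measurePreserving mp

lemma exp_layer (a q : ℝ) (ha : 0 < a) (hq : 0 ≤ q) :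
    ENNReal.ofReal (Real.exp (-a * q)) = ∫⁻ w in Set.Ioi (0:ℝ),
      (if q ≤ w then 1 else 0) * ENNReal.ofReal (a * Real.exp (-a * w)) := by
  rw [setLIntegral_congr Ioi_ae_eq_Ici]
  have h1 : ∀ w : ℝ, (if q ≤ w then (1:ℝ≥0∞) else 0) * ENNReal.ofReal (a * Real.exp (-a * w))
     = (Set.Ici q).indicator (fun w => ENNReal.ofReal (a * Real.exp (-a * w))) w := by
    intro w
    by_cases h : q ≤ w <;> simp [h]
  simp_rw [h1]
  rw [setLIntegral_indicator measurableSet_Ici]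
  have : Set.Ici q ∩ Set.Ici 0 = Set.Ici q := by
    rw [Set.Ici_inter_Ici]; simp [hq]
  rw [this, ← setLIntegral_congr Ioi_ae_eq_Ici, ← ofReal_integral_eq_lintegral_ofReal]
  · congr 1
    rw [integral_const_mul, integral_exp_mul_Ioi (by linarith)]
    field_simp
  · exact (integrableOn_exp_mul_Ioi (by linarith) q).const_mul a
  · exact Filter.Eventually.of_forall fun x => by positivity

lemma scale_change {d : ℕ} (w : ℝ) (hw : 0 < w) (f : (Fin d → ℝ) → ℝ≥0∞) (hf : Measurable f) :
    ∫⁻ x, f x = ENNReal.ofReal (w ^ (d / 2 : ℝ)) * ∫⁻ y, f (√w • y) := by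
  have hr : √w ≠ 0 := (Real.sqrt_pos.2 hw).ne'
  have hm := Measure.map_addHaar_smul (volume : Measure (Fin d → ℝ)) hr
  have := lintegral_map (μ := (volume : Measure (Fin d → ℝ))) hf (measurable_const_smul (√w))
  rw [← this, hm, lintegral_smul_measure, smul_eq_mul, ← mul_assoc,
    ← ENNReal.ofReal_mul (by positivity)]
  have h2 : w ^ (d / 2 : ℝ) * |(√w ^ Module.finrank ℝ (Fin d → ℝ))⁻¹| = 1 := by
    rw [Module.finrank_fin_fun, abs_of_pos (by positivity), Real.sqrt_eq_rpow, ← Real.rpow_natCast,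
      ← Real.rpow_mul hw.le]
    have : (1 / 2 : ℝ) * d = d / 2 := by ring
    rw [this]
    exact mul_inv_cancel₀ (by positivity)
  rw [h2]; simp

lemma sqNorm_smul {d : ℕ} (r : ℝ) (x : Fin d → ℝ) : sqNorm (r • x) = r ^ 2 * sqNorm x := by
  simp [sqNorm, Finset.mul_sum, mul_pow]

lemma gamma_int (a p t : ℝ) (ha : 0 < a) (hp : 0 ≤ p) (ht : 0 ≤ t) :
    ∫⁻ w in Set.Ioi (0:ℝ), ENNReal.ofReal (a * Real.exp (-a * w)) * 
      (ENNReal.ofReal (w ^ p) * ENNReal.ofReal (Real.exp (-(w * t)))) = 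
      ENNReal.ofReal (a * ((1 / (a + t)) ^ (p + 1) * Real.Gamma (p + 1))) := by
  have h := Real.integral_rpow_mul_exp_neg_mul_Ioi (a := p + 1) (r := a + t) (by linarith) (by linarith)
  rw [← h, ← integral_const_mul, ofReal_integral_eq_lintegral_ofReal]
  · refine setLIntegral_congr_fun measurableSet_Ioi fun w hw => ?_
    have hw : 0 < w := hw
    rw [← ENNReal.ofReal_mul (by positivity), ← ENNReal.ofReal_mul (by positivity)]
    congr 1
    have : Real.exp (-((a + t) * w)) = Real.exp (-a * w) * Real.exp (-(w * t)) := by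
      rw [← Real.exp_add]; congr 1; ring
    rw [this, add_sub_cancel_right]; ring
  · refine Integrable.const_mul ?_ a
    refine not_not.1 fun hn => ?_
    have h0 := integral_undef hn
    have h0' : (0:ℝ) < (1 / (a + t)) ^ (p + 1) * Real.Gamma (p + 1) := by
      have := Real.Gamma_pos_of_pos (s := p + 1) (by linarith)
      positivity
    rw [← h] at h0'
    exact h0'.ne' h0
  · filter_upwards [ae_restrict_mem measurableSet_Ioi] with w hw
    have hw : 0 < w := hw
    simp only [Pi.zero_apply]
    positivity

lemma GG_mix {d : ℕ} (hd : 0 < d) (A : Matrix (Fin d) (Fin d) ℝ) (s : ℝ) (hs : 0 ≤ s) :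
    GG A s = ∫⁻ y in unitBall d, ENNReal.ofReal ((d / 2 : ℝ) * 
      ((1 / ((d / 2 : ℝ) + s * sqNorm (A.mulVec y))) ^ ((d / 2 : ℝ) + 1) 
        * Real.Gamma ((d / 2 : ℝ) + 1))) := by
  have hd' : (0:ℝ) < d := by exact_mod_cast hd
  have hU : MeasurableSet (unitBall d) := by
    have : unitBall d = {x | sqNorm x ≤ 1} := rfl
    rw [this]
    exact measurableSet_le (by fun_prop) (by fun_prop)
  have mInd : Measurable (fun p : (Fin d → ℝ) × ℝ => if sqNorm p.1 ≤ p.2 then (1:ℝ≥0∞) else 0) := by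
    refine Measurable.ite (measurableSet_le (by fun_prop) (by fun_prop)) (by fun_prop) (by fun_prop)
  have mInd1 : Measurable (fun p : (Fin d → ℝ) => if sqNorm p ≤ 1 then (1:ℝ≥0∞) else 0) := by
    refine Measurable.ite (measurableSet_le (by fun_prop) (by fun_prop)) (by fun_prop) (by fun_prop)
  set a : ℝ := d / 2 with ha
  have ha0 : 0 < a := by positivity
  calc GG A s = ∫⁻ x : Fin d → ℝ, ∫⁻ w in Set.Ioi (0:ℝ), 
        ENNReal.ofReal (Real.exp (-s * sqNorm (A.mulVec x))) *
        ((if sqNorm x ≤ w then 1 else 0) * ENNReal.ofReal (a * Real.exp (-a * w))) := by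
        unfold GG
        refine lintegral_congr fun x => ?_
        rw [exp_layer _ _ ha0 (sqNorm_nonneg x), lintegral_const_mul]
        have := mInd.comp (measurable_prodMk_left (x := x))
        simp only [Function.comp_def] at this
        fun_prop
    _ = ∫⁻ w in Set.Ioi (0:ℝ), ∫⁻ x : Fin d → ℝ, 
        ENNReal.ofReal (Real.exp (-s * sqNorm (A.mulVec x))) *
        ((if sqNorm x ≤ w then 1 else 0) * ENNReal.ofReal (a * Real.exp (-a * w))) := by
        refine lintegral_lintegral_swap (Measurable.aemeasurable ?_)
        simp only [Function.uncurry_def]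
        fun_prop
    _ = ∫⁻ w in Set.Ioi (0:ℝ), ∫⁻ y : Fin d → ℝ, 
        (if sqNorm y ≤ 1 then 1 else 0) * (ENNReal.ofReal (a * Real.exp (-a * w)) * 
          (ENNReal.ofReal (w ^ a) * ENNReal.ofReal (Real.exp (-(w * (s * sqNorm (A.mulVec y))))))) := by
        refine setLIntegral_congr_fun measurableSet_Ioi fun w hw => ?_
        have hw : 0 < w := hw
        have := mInd.comp (measurable_prodMk_right (y := w))
        simp only [Function.comp_def] at this
        rw [scale_change w hw _ (by fun_prop), ← lintegral_const_mul]
        swap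
        · have m3 := this.comp (measurable_const_smul (√w))
          simp only [Function.comp_def] at m3
          have m4 : Measurable (fun y : Fin d → ℝ => A.mulVec (√w • y)) :=
            (mulVec_meas A).comp (measurable_const_smul (√w))
          fun_prop
        refine lintegral_congr fun y => ?_
        rw [Matrix.mulVec_smul, sqNorm_smul, sqNorm_smul, Real.sq_sqrt hw.le]
        have e1 : (w * sqNorm y ≤ w) = (sqNorm y ≤ 1) := by
          rw [mul_le_iff_le_one_right hw]
        simp only [e1]
        have e2 : -s * (w * sqNorm (A.mulVec y)) = -(w * (s * sqNorm (A.mulVec y))) := by ring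
        rw [e2]
        ring
    _ = ∫⁻ y : Fin d → ℝ, ∫⁻ w in Set.Ioi (0:ℝ), 
        (if sqNorm y ≤ 1 then 1 else 0) * (ENNReal.ofReal (a * Real.exp (-a * w)) * 
          (ENNReal.ofReal (w ^ a) * ENNReal.ofReal (Real.exp (-(w * (s * sqNorm (A.mulVec y))))))) := by
        refine lintegral_lintegral_swap (Measurable.aemeasurable ?_)
        have m2 : Measurable (fun p : ℝ × (Fin d → ℝ) => if sqNorm p.2 ≤ 1 then (1:ℝ≥0∞) else 0) :=
          mInd1.comp measurable_snd
        simp only [Function.uncurry_def]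
        fun_prop
    _ = _ := by
        rw [← lintegral_indicator hU]
        refine lintegral_congr fun y => ?_
        rw [lintegral_const_mul _ (by fun_prop), gamma_int _ _ _ ha0 ha0.le
          (mul_nonneg hs (sqNorm_nonneg _))]
        by_cases hy : y ∈ unitBall d
        · have : sqNorm y ≤ 1 := hy
          simp [hy, this]
        · have : ¬ sqNorm y ≤ 1 := hy
          simp [hy, this]

lemma measSet_unitBall (d : ℕ) : MeasurableSet (unitBall d) := by
  have : unitBall d = {x | sqNorm x ≤ 1} := rfl
  rw [this]
  exact measurableSet_le (by fun_prop) (by fun_prop)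

lemma ball_point (a t : ℝ) (ha : 1 / 2 ≤ a) (ht : 0 ≤ t) :
    a * ((1 / a) ^ (a + 1) * Real.Gamma (a + 1)) * Real.exp (-3 * t) ≤ 
      a * ((1 / (a + t)) ^ (a + 1) * Real.Gamma (a + 1)) := by
  have ha0 : 0 < a := by linarith
  have hG := Real.Gamma_pos_of_pos (s := a + 1) (by linarith)
  have h1 : (1 / a) * Real.exp (- (t / a)) ≤ 1 / (a + t) := by
    rw [Real.exp_neg, ← div_eq_mul_inv, div_div, ]
    refine one_div_le_one_div_of_le (by positivity) ?_
    have := Real.add_one_le_exp (t / a)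
    calc a + t = a * (t / a + 1) := by field_simp; ring
      _ ≤ _ := by gcongr
  have h2 : ((1 / a) * Real.exp (- (t / a))) ^ (a + 1) ≤ (1 / (a + t)) ^ (a + 1) :=
    Real.rpow_le_rpow (by positivity) h1 (by linarith)
  rw [Real.mul_rpow (by positivity) (by positivity), ← Real.exp_mul] at h2
  have h3 : Real.exp (-3 * t) ≤ Real.exp (-(t / a) * (a + 1)) := by
    apply Real.exp_le_exp.2
    have : t / a * (a + 1) = t + t / a := by field_simp
    have h4 : t / a ≤ 2 * t := by
      rw [div_le_iff₀ ha0]; nlinarith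
    linarith
  calc _ = a * ((1 / a) ^ (a + 1) * Real.exp (-3 * t) * Real.Gamma (a + 1)) := by ring
    _ ≤ a * ((1 / a) ^ (a + 1) * Real.exp (-(t / a) * (a + 1)) * Real.Gamma (a + 1)) := by gcongr
    _ ≤ _ := by gcongr

lemma ball_facts {d : ℕ} (hd : 0 < d) (A : Matrix (Fin d) (Fin d) ℝ) : ∃ k : ℝ≥0∞,
    GG A 0 = k * volume (unitBall d) ∧ 
    ∀ s, 0 ≤ s → k * ∫⁻ y in unitBall d, ENNReal.ofReal (Real.exp (-(3 * s) * sqNorm (A.mulVec y)))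
      ≤ GG A s := by
  have hd' : (1:ℝ) ≤ d := by exact_mod_cast hd
  refine ⟨ENNReal.ofReal ((d / 2 : ℝ) * 
      ((1 / (d / 2 : ℝ)) ^ ((d / 2 : ℝ) + 1) * Real.Gamma ((d / 2 : ℝ) + 1))), ?_, ?_⟩
  · rw [GG_mix hd A 0 le_rfl]
    simp
  · intro s hs
    rw [GG_mix hd A s hs, ← lintegral_const_mul _ (by fun_prop)]
    refine lintegral_mono fun y => ?_
    have hG := Real.Gamma_pos_of_pos (s := (d / 2 : ℝ) + 1) (by linarith)
    rw [← ENNReal.ofReal_mul (by positivity)]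
    refine ENNReal.ofReal_le_ofReal ?_
    have := ball_point (d / 2) (s * sqNorm (A.mulVec y)) (by linarith) 
      (mul_nonneg hs (sqNorm_nonneg _))
    convert this using 3
    ring

lemma ball_vol {d : ℕ} (hd : 0 < d) : 
    volume (unitBall d) ≠ 0 ∧ volume (unitBall d) ≠ ∞ := by
  refine ⟨?_, ?_⟩
  · obtain ⟨k, hk, -⟩ := ball_facts hd (1 : Matrix (Fin d) (Fin d) ℝ)
    intro h
    rw [h, mul_zero] at hk
    exact (GG_zero hd _).1 hk
  · have : unitBall d ⊆ Set.Icc (fun _ => -1) (fun _ => 1) := by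
      intro x hx
      have hx : ∑ i, (x i) ^ 2 ≤ 1 := hx
      have : ∀ i, (x i) ^ 2 ≤ 1 := fun i => 
        (Finset.single_le_sum (f := fun i => (x i) ^ 2) (fun _ _ => sq_nonneg _) (Finset.mem_univ i)).trans hx
      exact ⟨fun i => (abs_le_one_iff_mul_self_le_one.2 (by nlinarith [this i]) |> abs_le.1).1,
        fun i => (abs_le_one_iff_mul_self_le_one.2 (by nlinarith [this i]) |> abs_le.1).2⟩
    exact ((measure_mono this).trans_lt isCompact_Icc.measure_lt_top).ne

lemma ball_prob {d : ℕ} (hd : 0 < d) : IsProbabilityMeasure (uniformBall d) := by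
  constructor
  simp only [uniformBall, Measure.smul_apply, Measure.restrict_apply_univ, smul_eq_mul]
  exact ENNReal.inv_mul_cancel (ball_vol hd).1 (ball_vol hd).2

lemma ball_laplace {d : ℕ} (hd : 0 < d) (A : Matrix (Fin d) (Fin d) ℝ) (s : ℝ) (hs : 0 ≤ s) :
    (∫⁻ x, ENNReal.ofReal (Real.exp (-(3 * s) * sqNorm (A.mulVec x))) ∂(uniformBall d)) * GG A 0
      ≤ GG A s := by
  obtain ⟨k, hk, h⟩ := ball_facts hd A
  refine le_trans (le_of_eq ?_) (h s hs)
  rw [uniformBall, lintegral_smul_measure, hk, smul_eq_mul]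
  calc _ = ((volume (unitBall d))⁻¹ * volume (unitBall d)) * (k * ∫⁻ y in unitBall d, 
        ENNReal.ofReal (Real.exp (-(3 * s) * sqNorm (A.mulVec y)))) := by ring
    _ = _ := by rw [ENNReal.inv_mul_cancel (ball_vol hd).1 (ball_vol hd).2, one_mul]

lemma ball_memLp {d : ℕ} (hd : 0 < d) (j : Fin d) :
    MemLp (fun x : Fin d → ℝ => x j) 2 (uniformBall d) := by
  have := ball_prob hd
  refine MemLp.of_bound (measurable_pi_apply j).aestronglyMeasurable 1 ?_
  have : ∀ᵐ x ∂(uniformBall d), x ∈ unitBall d := by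
    unfold uniformBall
    exact Measure.ae_smul_measure (ae_restrict_mem (measSet_unitBall d)) _
  filter_upwards [this] with x hx
  have hx : ∑ i, (x i) ^ 2 ≤ 1 := hx
  have := (Finset.single_le_sum (f := fun i => (x i) ^ 2) (fun _ _ => sq_nonneg _) 
    (Finset.mem_univ j)).trans hx
  rw [Real.norm_eq_abs]
  exact abs_le_one_iff_mul_self_le_one.2 (by nlinarith)

lemma integrable_X {d : ℕ} (μ : Measure (Fin d → ℝ)) 
    (h : ∀ j, MemLp (fun x : Fin d → ℝ => x j) 2 μ) (A : Matrix (Fin d) (Fin d) ℝ) :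
    Integrable (fun x => sqNorm (A.mulVec x)) μ := by
  unfold sqNorm
  refine integrable_finsetSum _ fun i _ => ?_
  refine MemLp.integrable_sq ?_
  simp only [Matrix.mulVec, dotProduct]
  exact memLp_finsetSum _ fun j _ => (h j).const_mul _

lemma core {Ω : Type*} [MeasurableSpace Ω] (μ : Measure Ω) [IsProbabilityMeasure μ] (X : Ω → ℝ)
    (hXm : Measurable X)
    (hX : Integrable X μ) (u E : ℝ) 
    (hL : ∫⁻ x, ENNReal.ofReal (Real.exp (-u * X x)) ∂μ ≤ ENNReal.ofReal (Real.exp (-E)))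
    (U : Set Ω) (hU : 0 < μ U) :
    E + Real.log (μ U).toReal ≤ u * ∫ x, X x ∂(ProbabilityTheory.cond μ U) := by
  have hp : 0 < (μ U).toReal := ENNReal.toReal_pos hU.ne' (measure_ne_top _ _)
  have : IsProbabilityMeasure (ProbabilityTheory.cond μ U) := cond_isProbabilityMeasure hU.ne'
  have hint : Integrable (fun x => Real.exp (-u * X x)) μ := by
    refine ⟨by fun_prop, ?_⟩
    rw [hasFiniteIntegral_iff_ofReal (Filter.Eventually.of_forall fun x => by positivity)]
    exact hL.trans_lt ENNReal.ofReal_lt_top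
  have hi : (μ U)⁻¹ ≠ ∞ := ENNReal.inv_ne_top.2 hU.ne'
  have hXν : Integrable X (ProbabilityTheory.cond μ U) := hX.restrict.smul_measure hi
  have hEν : Integrable (fun x => Real.exp (-u * X x)) (ProbabilityTheory.cond μ U) := 
    hint.restrict.smul_measure hi
  set a := E + Real.log (μ U).toReal with ha
  have h1 : ∫ x, Real.exp (-u * X x) ∂(ProbabilityTheory.cond μ U) ≤ Real.exp (-a) := by
    have e : ∫ x, Real.exp (-u * X x) ∂μ ≤ Real.exp (-E) := by
      rw [← ofReal_integral_eq_lintegral_ofReal hint 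
        (Filter.Eventually.of_forall fun x => by positivity)] at hL
      exact (ENNReal.ofReal_le_ofReal_iff (by positivity)).1 hL
    have e2 : ∫ x in U, Real.exp (-u * X x) ∂μ ≤ ∫ x, Real.exp (-u * X x) ∂μ := 
      setIntegral_le_integral hint (Filter.Eventually.of_forall fun x => by positivity)
    rw [ProbabilityTheory.cond, integral_smul_measure, smul_eq_mul, ENNReal.toReal_inv, ha, neg_add,
      Real.exp_add, Real.exp_neg (Real.log _), Real.exp_log hp, mul_comm]
    gcongr
    exact e2.trans e
  have h2 : ∫ x, Real.exp (-a) * (1 + a - u * X x) ∂(ProbabilityTheory.cond μ U) ≤ 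
      ∫ x, Real.exp (-u * X x) ∂(ProbabilityTheory.cond μ U) := by
    refine integral_mono (((integrable_const _).sub (hXν.const_mul u)).const_mul _) hEν fun x => ?_
    have := Real.add_one_le_exp (a - u * X x)
    calc _ ≤ Real.exp (-a) * Real.exp (a - u * X x) := by 
          have h3 : 1 + a - u * X x ≤ Real.exp (a - u * X x) := by linarith
          gcongr
      _ = _ := by rw [← Real.exp_add]; ring_nf
  rw [integral_const_mul, integral_sub (integrable_const _) (hXν.const_mul u), integral_const_mul] at h2
  simp only [integral_const, probReal_univ, smul_eq_mul, one_mul] at h2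
  have h3 := h2.trans h1
  have h4 : 0 < Real.exp (-a) := Real.exp_pos _
  have h5 : 1 + a - u * ∫ x, X x ∂(ProbabilityTheory.cond μ U) ≤ 1 := by
    by_contra hc
    push Not at hc
    nlinarith
  linarith

lemma top_set {d : ℕ} (l : Fin d → ℝ) (k : ℕ) (hk : k ≤ d) :
    ∃ S : Finset (Fin d), S.card = k ∧ ∀ i ∈ S, ∀ j ∉ S, l j ≤ l i := by
  induction k with
  | zero => exact ⟨∅, by simp⟩
  | succ k ih =>
    obtain ⟨S, hS, h⟩ := ih (by omega)
    have hne : (Sᶜ).Nonempty := by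
      rw [← Finset.card_pos, Finset.card_compl, Fintype.card_fin]; omega
    obtain ⟨m, hm, hmax⟩ := Finset.exists_max_image Sᶜ l hne
    have hm' : m ∉ S := by simpa using hm
    refine ⟨insert m S, by rw [Finset.card_insert_of_notMem hm', hS], ?_⟩
    intro i hi j hj
    simp only [Finset.mem_insert, not_or] at hi hj
    rcases hi with rfl | hi
    · exact hmax j (by simpa using hj.2)
    · exact h i hi j hj.2

lemma frob_trace {d : ℕ} (N : Matrix (Fin d) (Fin d) ℝ) : frobSq N = (N * Nᵀ).trace := by
  simp [frobSq, Matrix.trace, Matrix.mul_apply, sq]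

lemma low_rank {d : ℕ} (A V : Matrix (Fin d) (Fin d) ℝ) (l : Fin d → ℝ)
    (hV : Vᵀ * V = 1) (h : Vᵀ * (Aᵀ * A) * V = Matrix.diagonal l) (S : Finset (Fin d)) :
    ∃ M : Matrix (Fin d) (Fin d) ℝ, M.rank ≤ S.card ∧ frobSq (A - M) = ∑ i ∈ Sᶜ, l i := by
  have hV' : V * Vᵀ = 1 := mul_eq_one_comm.1 hV
  let D : Matrix (Fin d) (Fin d) ℝ := Matrix.diagonal fun i => if i ∈ S then 1 else 0
  let D' : Matrix (Fin d) (Fin d) ℝ := Matrix.diagonal fun i => if i ∈ S then 0 else 1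
  refine ⟨A * V * D * Vᵀ, ?_, ?_⟩
  · calc _ ≤ (A * V * D).rank := Matrix.rank_mul_le_left _ _
      _ ≤ D.rank := Matrix.rank_mul_le_right _ _
      _ ≤ S.card := by
        classical
        simp only [D]
        rw [Matrix.rank_diagonal, Fintype.card_subtype]
        refine Finset.card_le_card fun i hi => ?_
        simpa using hi
  · have e : A - A * V * D * Vᵀ = A * V * D' * Vᵀ := by
      have : D' = 1 - D := by
        simp only [D, D']
        rw [← Matrix.diagonal_one, Matrix.diagonal_sub]
        congr 1; funext i; split_ifs <;> simp
      rw [this, Matrix.mul_sub, Matrix.sub_mul, Matrix.mul_one, Matrix.mul_assoc A V Vᵀ, hV',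
        Matrix.mul_one]
    have hT : D'ᵀ = D' := by simp [D']
    rw [e, frob_trace]
    have e2 : A * V * D' * Vᵀ * (A * V * D' * Vᵀ)ᵀ = (A * V * D') * (D' * Vᵀ * Aᵀ) := by
      simp only [Matrix.transpose_mul, Matrix.transpose_transpose, hT]
      calc _ = A * V * D' * (Vᵀ * V) * (D' * (Vᵀ * Aᵀ)) := by simp only [Matrix.mul_assoc]
        _ = _ := by rw [hV, Matrix.mul_one]; simp only [Matrix.mul_assoc]
    rw [e2, Matrix.trace_mul_comm]
    have e3 : D' * Vᵀ * Aᵀ * (A * V * D') = D' * Matrix.diagonal l * D' := by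
      rw [← h]; simp only [Matrix.mul_assoc]
    rw [e3]
    simp only [D', Matrix.diagonal_mul_diagonal, Matrix.trace_diagonal]
    rw [← Finset.sum_subset (Finset.subset_univ Sᶜ)]
    · refine Finset.sum_congr rfl fun i hi => ?_
      have : i ∉ S := by simpa using hi
      simp [this]
    · intro i _ hi
      have : i ∈ S := by simpa using hi
      simp [this]

lemma frobSq_nonneg {d : ℕ} (N : Matrix (Fin d) (Fin d) ℝ) : 0 ≤ frobSq N :=
  Finset.sum_nonneg fun _ _ => Finset.sum_nonneg fun _ _ => sq_nonneg _

lemma log_lower (u : ℝ) (h0 : 0 ≤ u) (h1 : u ≤ 1) : u / 2 ≤ Real.log (1 + u) := by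
  have := Real.one_sub_inv_le_log_of_pos (x := 1 + u) (by linarith)
  refine le_trans ?_ this
  have : (1 + u)⁻¹ * (1 + u) = 1 := inv_mul_cancel₀ (by linarith)
  have h2 : 1 - (1 + u)⁻¹ = u / (1 + u) := by field_simp; ring
  rw [h2]
  exact div_le_div_of_nonneg_left h0 (by linarith) (by linarith)

lemma general {d : ℕ} (hd : 0 < d) (μ : Measure (Fin d → ℝ)) [IsProbabilityMeasure μ]
    (hm : ∀ j, MemLp (fun x : Fin d → ℝ => x j) 2 μ) 
    (hL : ∀ (A : Matrix (Fin d) (Fin d) ℝ) (s : ℝ), 0 ≤ s → 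
      (∫⁻ x, ENNReal.ofReal (Real.exp (-(3 * s) * sqNorm (A.mulVec x))) ∂μ) * GG A 0 ≤ GG A s)
    (U : Set (Fin d → ℝ)) (hU : 0 < μ U) (A : Matrix (Fin d) (Fin d) ℝ) (κ : ℕ)
    (hκ : (κ : ℝ) ≥ 4 * (1 + Real.log (1 / (μ U).toReal))) :
    ((1/6 : ℝ) / d) * (⨅ M : {M : Matrix (Fin d) (Fin d) ℝ // M.rank ≤ κ}, frobSq (A - M.1)) ≤
      ∫ x, sqNorm (A.mulVec x) ∂(ProbabilityTheory.cond μ U) := by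
  have hd' : (0:ℝ) < d := by exact_mod_cast hd
  have hbdd : BddBelow (Set.range fun M : {M : Matrix (Fin d) (Fin d) ℝ // M.rank ≤ κ} => 
      frobSq (A - M.1)) := ⟨0, by rintro _ ⟨M, rfl⟩; exact frobSq_nonneg _⟩
  have hR : 0 ≤ ∫ x, sqNorm (A.mulVec x) ∂(ProbabilityTheory.cond μ U) := 
    integral_nonneg fun x => sqNorm_nonneg _
  by_cases hkd : d ≤ κ
  · have : (⨅ M : {M : Matrix (Fin d) (Fin d) ℝ // M.rank ≤ κ}, frobSq (A - M.1)) ≤ 0 := by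
      refine (ciInf_le hbdd ⟨A, ?_⟩).trans ?_
      · exact (Matrix.rank_le_width A).trans hkd
      · simp [frobSq]
    refine le_trans ?_ hR
    exact mul_nonpos_of_nonneg_of_nonpos (by positivity) this
  push Not at hkd
  obtain ⟨V, l, hV, hl, h⟩ := decomp A
  obtain ⟨S, hS, hSl⟩ := top_set l κ hkd.le
  obtain ⟨M, hM, hMf⟩ := low_rank A V l hV h S
  have hinf : (⨅ M : {M : Matrix (Fin d) (Fin d) ℝ // M.rank ≤ κ}, frobSq (A - M.1)) ≤ 
      ∑ i ∈ Sᶜ, l i := by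
    rw [← hMf]
    exact ciInf_le hbdd ⟨M, hS ▸ hM⟩
  refine (mul_le_mul_of_nonneg_left hinf (by positivity)).trans ?_
  set T := ∑ i ∈ Sᶜ, l i with hT
  have hne : (Sᶜ).Nonempty := by
    rw [← Finset.card_pos, Finset.card_compl, Fintype.card_fin]; omega
  obtain ⟨m, hm1, hmax⟩ := Finset.exists_max_image Sᶜ l hne
  have hmS : m ∉ S := by simpa using hm1
  rcases (hl m).eq_or_lt with h0 | hpos
  · have : T = 0 := Finset.sum_eq_zero fun i hi => le_antisymm (h0 ▸ hmax i hi) (hl i)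
    rw [this]; simpa using hR
  set τ := l m with hτ
  set s : ℝ := d / (2 * τ) with hs
  have hs0 : 0 < s := by positivity
  have hlap : ∫⁻ x, ENNReal.ofReal (Real.exp (-(3 * s) * sqNorm (A.mulVec x))) ∂μ ≤ 
      ENNReal.ofReal (Real.exp (-((1/2) * ∑ i, Real.log (1 + 2 * s * l i / d)))) := by
    have := hL A s hs0.le
    rw [GG_ratio hd A V l hV hl h s hs0.le] at this
    rw [neg_mul (1/2 : ℝ)] at this
    exact (ENNReal.mul_le_mul_iff_left (GG_zero hd A).1 (GG_zero hd A).2).1 this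
  have hc := core μ (fun x => sqNorm (A.mulVec x)) (by fun_prop) (integrable_X μ hm A) (3 * s) _ hlap U hU
  set I := ∫ x, sqNorm (A.mulVec x) ∂(ProbabilityTheory.cond μ U) with hI
  have hsum : (κ : ℝ) / 2 + T / τ / 2 ≤ ∑ i, Real.log (1 + 2 * s * l i / d) := by
    have e : ∀ i, 2 * s * l i / d = l i / τ := by
      intro i; rw [hs]; field_simp
    simp_rw [e]
    rw [← Finset.sum_add_sum_compl S]
    refine add_le_add ?_ ?_
    · have : (κ : ℝ) / 2 = ∑ i ∈ S, (1/2 : ℝ) := by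
        rw [Finset.sum_const, hS]; simp; ring
      rw [this]
      refine Finset.sum_le_sum fun i hi => (log_lower 1 (by norm_num) le_rfl).trans ?_
      refine Real.log_le_log (by norm_num) ?_
      have : 1 ≤ l i / τ := (one_le_div hpos).2 (hSl i hi m hmS)
      linarith
    · rw [hT, Finset.sum_div, Finset.sum_div]
      refine Finset.sum_le_sum fun i hi => log_lower _ (div_nonneg (hl i) hpos.le) ?_
      exact (div_le_one hpos).2 (hmax i hi)
  have hlog : Real.log (1 / (μ U).toReal) = - Real.log (μ U).toReal := by
    rw [one_div, Real.log_inv]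
  rw [hlog] at hκ
  have h1 : T / τ / 4 ≤ 3 * s * I := by linarith
  have h2 : T / τ / 4 = 3 * s * (1 / 6 / d * T) := by
    rw [hs]; field_simp; ring
  rw [h2] at h1
  exact le_of_mul_le_mul_left h1 (by positivity)


/-- Approximating linear functions over large-volume sets: there are universal constants
`C, c > 0` such that if `μ` is `N(0, I_d/d)` or `Unif[B_d]`, `U` is measurable with
`μ(U) > 0`, `f₁(x) = A₁x`, `f₂(x) = A₂x`, and `κ ≥ C(1 + log(1/μ(U)))`, then
`E_{x∼μ|_U} ‖f₁(x) − f₂(x)‖² ≥ (c/d) min_{rank(M) ≤ κ} ‖A₁ − A₂ − M‖_F²`. -/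
theorem linear_approx_over_large_volume_sets :
    ∃ C c : ℝ, 0 < C ∧ 0 < c ∧
      ∀ (d : ℕ) (μ : Measure (Fin d → ℝ)),
        (μ = stdGaussianScaled d ∨ μ = uniformBall d) →
        ∀ U : Set (Fin d → ℝ), MeasurableSet U → 0 < μ U →
          ∀ A₁ A₂ : Matrix (Fin d) (Fin d) ℝ,
            ∀ κ : ℕ, (κ : ℝ) ≥ C * (1 + Real.log (1 / (μ U).toReal)) →
              (c / d) *
                  (⨅ M : {M : Matrix (Fin d) (Fin d) ℝ // M.rank ≤ κ},
                    frobSq (A₁ - A₂ - M.1)) ≤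
                ∫ x, sqNorm (A₁.mulVec x - A₂.mulVec x)
                  ∂(ProbabilityTheory.cond μ U) := by
  refine ⟨4, 1/6, by norm_num, by norm_num, ?_⟩
  intro d μ hμ U _ hpos A₁ A₂ κ hκ
  rcases Nat.eq_zero_or_pos d with h0 | hd
  · subst h0
    simp only [Nat.cast_zero, div_zero, zero_mul]
    exact integral_nonneg fun x => sqNorm_nonneg _
  simp_rw [← Matrix.sub_mulVec]
  rcases hμ with rfl | rfl
  · refine general hd _ (gauss_memLp d) (fun A s hs => ?_) U hpos (A₁ - A₂) κ hκ
    refine le_trans ?_ (gauss_laplace hd A s).le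
    refine mul_le_mul_left (lintegral_mono fun x => ENNReal.ofReal_le_ofReal (Real.exp_le_exp.2 ?_)) _
    have := mul_nonneg hs (sqNorm_nonneg (A.mulVec x))
    linarith
  · have := ball_prob hd
    exact general hd _ (ball_memLp hd) (fun A s hs => ball_laplace hd A s hs) U hpos (A₁ - A₂) κ hκ

end
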